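/- arXiv:2501.11504 — 2 statements merged into one kernel-verified Lean document; each statement's English description precedes it below -/
import Mathlib

section
/- Let A and B be associative, not necessarily unital ℂ-algebras, let E be a cofull right functional A-module whose functional space Θ_A(E) is also cofull, assume A has a left approximate unit and that the compact operator algebra K_A(E) has a two-sided approximate unit, and let π : A → B be an algebra homomorphism. Then K_B(E ⊗_π B) has a two-sided approximate unit. -/
open scoped BigOperators TensorProduct

noncomputable section

/-- A right module structure for a (not necessarily unital) ℂ-algebra `A`
on a ℂ-vector space `E`. -/
structure RightMod (A : Type*) [NonUnitalRing A] [Module ℂ A]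
    (E : Type*) [AddCommGroup E] [Module ℂ E] where
  sm : E → A → E
  add_sm : ∀ (x y : E) (a : A), sm (x + y) a = sm x a + sm y a
  sm_add : ∀ (x : E) (a b : A), sm x (a + b) = sm x a + sm x b
  sm_mul : ∀ (x : E) (a b : A), sm (sm x a) b = sm x (a * b)
  csm_left : ∀ (c : ℂ) (x : E) (a : A), sm (c • x) a = c • sm x a
  csm_right : ∀ (c : ℂ) (x : E) (a : A), sm x (c • a) = c • sm x a

variable {A : Type*} [NonUnitalRing A] [Module ℂ A]

/-- `f : E → A` is a right `A`-module homomorphism into the standard module `A`. -/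
def IsFunctional {E : Type*} [AddCommGroup E] [Module ℂ E]
    (r : RightMod A E) (f : E → A) : Prop :=
  (∀ x y : E, f (x + y) = f x + f y) ∧ (∀ (c : ℂ) (x : E), f (c • x) = c • f x) ∧
    ∀ (x : E) (a : A), f (r.sm x a) = f x * a

/-- `Θ` is a functional space for the right `A`-module `(E, r)`:
a `G`-invariant left `A`-submodule of `Hom_A(E,A)`. -/
structure IsFunctionalSpace {E : Type*} [AddCommGroup E] [Module ℂ E]
    (r : RightMod A E) (Θ : Set (E → A)) : Prop where
  functional : ∀ φ ∈ Θ, IsFunctional r φ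
  zero_mem : (0 : E → A) ∈ Θ
  add_mem : ∀ {φ ψ : E → A}, φ ∈ Θ → ψ ∈ Θ → φ + ψ ∈ Θ
  neg_mem : ∀ {φ : E → A}, φ ∈ Θ → -φ ∈ Θ
  csmul_mem : ∀ (c : ℂ) {φ : E → A}, φ ∈ Θ → c • φ ∈ Θ
  lsmul_mem : ∀ (a : A) {φ : E → A}, φ ∈ Θ → (fun x => a * φ x) ∈ Θ

/-- Right `A`-module homomorphism between two right `A`-modules. -/
def IsModHom {E F : Type*} [AddCommGroup E] [Module ℂ E] [AddCommGroup F] [Module ℂ F]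
    (rE : RightMod A E) (rF : RightMod A F) (U : E → F) : Prop :=
  (∀ x y : E, U (x + y) = U x + U y) ∧ (∀ (c : ℂ) (x : E), U (c • x) = c • U x) ∧
    ∀ (x : E) (a : A), U (rE.sm x a) = rF.sm (U x) a

/-- A homomorphism of functional modules `(U, U^*)`. -/
structure IsFunctionalHom {E F : Type*} [AddCommGroup E] [Module ℂ E]
    [AddCommGroup F] [Module ℂ F]
    (rE : RightMod A E) (ΘE : Set (E → A)) (rF : RightMod A F) (ΘF : Set (F → A))
    (U : E → F) (Ustar : (E → A) → F → A) : Prop where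
  hom : IsModHom rE rF U
  maps_mem : ∀ {φ : E → A}, φ ∈ ΘE → Ustar φ ∈ ΘF
  star_add : ∀ {φ ψ : E → A}, φ ∈ ΘE → ψ ∈ ΘE → Ustar (φ + ψ) = Ustar φ + Ustar ψ
  star_csmul : ∀ (c : ℂ) {φ : E → A}, φ ∈ ΘE → Ustar (c • φ) = c • Ustar φ
  star_lsmul : ∀ (a : A) {φ : E → A}, φ ∈ ΘE →
      Ustar (fun x => a * φ x) = fun y => a * Ustar φ y
  compat : ∀ {φ : E → A}, φ ∈ ΘE → ∀ x : E, Ustar φ (U x) = φ x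

/-- A functional extension. -/
structure IsFunctionalExtension {E F : Type*} [AddCommGroup E] [Module ℂ E]
    [AddCommGroup F] [Module ℂ F]
    (rE : RightMod A E) (ΘE : Set (E → A)) (rF : RightMod A F) (ΘF : Set (F → A))
    (U : E → F) (Ustar : (E → A) → F → A)
    extends IsFunctionalHom rE ΘE rF ΘF U Ustar : Prop where
  inj : Function.Injective U
  lift : ∀ (k : ℕ) (φ : Fin k → E → A), (∀ i, φ i ∈ ΘE) → ∀ η : F,
      ∃ ξ : E, ∀ i, Ustar (φ i) η = φ i ξ

/-- The elementary compact operator `θ_{η,φ}`. -/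
def elemOp {E : Type*} [AddCommGroup E] [Module ℂ E]
    (r : RightMod A E) (η : E) (φ : E → A) : E → E :=
  fun ξ => r.sm η (φ ξ)

/-- The set of compact operators on `(E, r, Θ)`: finite sums of elementary operators. -/
def KSet {E : Type*} [AddCommGroup E] [Module ℂ E]
    (r : RightMod A E) (Θ : Set (E → A)) : Set (E → E) :=
  { T | ∃ (m : ℕ) (η : Fin m → E) (φ : Fin m → E → A),
      (∀ i, φ i ∈ Θ) ∧ T = ∑ i, elemOp r (η i) (φ i) }

end

section Std

variable (A : Type*) [NonUnitalRing A] [Module ℂ A] [SMulCommClass ℂ A A] [IsScalarTower ℂ A A]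

/-- The standard right functional `A`-module structure on `A^n = n →₀ A`
(finitely supported families). -/
noncomputable def stdMod (n : Type*) : RightMod A (n →₀ A) where
  sm x a := Finsupp.mapRange (· * a) (zero_mul a) x
  add_sm x y a := by ext i; simp [add_mul]
  sm_add x a b := by ext i; simp [mul_add]
  sm_mul x a b := by ext i; simp [mul_assoc]
  csm_left c x a := by ext i; simp [smul_mul_assoc]
  csm_right c x a := by ext i; simp [mul_smul_comm]

/-- The standard functional space on `A^n`: the vectors `x ∈ A^n` acting by
`x(ξ) = Σ_i x_i * ξ_i`. -/
def stdTheta (n : Type*) : Set ((n →₀ A) → A) :=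
  { f | ∃ x : n →₀ A, ∀ ξ : n →₀ A, f ξ = x.sum fun i xi => xi * ξ i }

end Std

section Units

variable (A : Type*) [NonUnitalRing A]

/-- `A` has a left approximate unit (discrete version: finitely many elements
admit a simultaneous left unit). -/
def HasLeftApproxUnit : Prop :=
  ∀ (m : ℕ) (a : Fin m → A), ∃ u : A, ∀ i, u * a i = a i

/-- `A` has a right approximate unit. -/
def HasRightApproxUnit : Prop :=
  ∀ (m : ℕ) (a : Fin m → A), ∃ u : A, ∀ i, a i * u = a i

/-- `A` has a two-sided approximate unit. -/
def HasTwoSidedApproxUnit : Prop :=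
  ∀ (m : ℕ) (a : Fin m → A), ∃ u : A, ∀ i, u * a i = a i ∧ a i * u = a i

end Units

section KUnits

variable {A E : Type*} [NonUnitalRing A] [Module ℂ A] [AddCommGroup E] [Module ℂ E]

/-- The algebra of compact operators of `(E, r, Θ)` has a left approximate unit
(multiplication being composition of operators). -/
def KSetHasLeftApproxUnit (r : RightMod A E) (Θ : Set (E → A)) : Prop :=
  ∀ (m : ℕ) (T : Fin m → E → E), (∀ i, T i ∈ KSet r Θ) →
    ∃ u ∈ KSet r Θ, ∀ i, u ∘ T i = T i

/-- The algebra of compact operators of `(E, r, Θ)` has a right approximate unit. -/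
def KSetHasRightApproxUnit (r : RightMod A E) (Θ : Set (E → A)) : Prop :=
  ∀ (m : ℕ) (T : Fin m → E → E), (∀ i, T i ∈ KSet r Θ) →
    ∃ u ∈ KSet r Θ, ∀ i, T i ∘ u = T i

/-- The algebra of compact operators of `(E, r, Θ)` has a two-sided approximate unit. -/
def KSetHasTwoSidedApproxUnit (r : RightMod A E) (Θ : Set (E → A)) : Prop :=
  ∀ (m : ℕ) (T : Fin m → E → E), (∀ i, T i ∈ KSet r Θ) →
    ∃ u ∈ KSet r Θ, ∀ i, u ∘ T i = T i ∧ T i ∘ u = T i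

end KUnits

section Cofull

variable {A E : Type*} [NonUnitalRing A] [Module ℂ A] [AddCommGroup E] [Module ℂ E]

/-- The functional module `E` is cofull. -/
def CofullModule (r : RightMod A E) (Θ : Set (E → A)) : Prop :=
  ∀ x : E, ∃ (m : ℕ) (ξ η : Fin m → E) (φ : Fin m → E → A),
    (∀ i, φ i ∈ Θ) ∧ x = ∑ i, r.sm (ξ i) (φ i (η i))

/-- The functional space `Θ` is cofull. -/
def CofullTheta (r : RightMod A E) (Θ : Set (E → A)) : Prop :=
  ∀ τ' ∈ Θ, ∃ (m : ℕ) (ξ : Fin m → E) (φ τ : Fin m → E → A),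
    (∀ i, φ i ∈ Θ) ∧ (∀ i, τ i ∈ Θ) ∧ τ' = ∑ i, fun x => φ i (ξ i) * τ i x

end Cofull

section ITP

variable {A B E EB : Type*} [NonUnitalRing A] [Module ℂ A] [NonUnitalRing B] [Module ℂ B]
  [AddCommGroup E] [Module ℂ E] [AddCommGroup EB] [Module ℂ EB]

/-- A (not necessarily unital) algebra homomorphism of ℂ-algebras. -/
def IsAlgHom (π : A → B) : Prop :=
  (∀ x y, π (x + y) = π x + π y) ∧ (∀ x y, π (x * y) = π x * π y) ∧
    ∀ (c : ℂ) (x : A), π (c • x) = c • π x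

/-- The defining relations of the internal tensor product `E ⊗_π B`. -/
def itpRelations (π : A → B) (rE : RightMod A E) : Set (TensorProduct ℂ E B) :=
  { z | ∃ (ξ : E) (a : A) (b : B), z = (rE.sm ξ a) ⊗ₜ[ℂ] b - ξ ⊗ₜ[ℂ] (π a * b) }

/-- `(EB, rEB, t)` realizes the internal tensor product `E ⊗_π B`:
`EB` is, via a ℂ-linear surjection with kernel the span of the defining relations,
the quotient `(E ⊗_ℂ B)/span{ξa ⊗ b − ξ ⊗ π(a)b}`, with `t ξ b` the class of `ξ ⊗ b`,
and the right `B`-action satisfies `(ξ ⊗ b)·b' = ξ ⊗ (bb')`. -/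
structure IsInternalTensor (π : A → B) (rE : RightMod A E) (rEB : RightMod B EB)
    (t : E → B → EB) : Prop where
  exists_quot : ∃ q : TensorProduct ℂ E B →ₗ[ℂ] EB, Function.Surjective q ∧
      LinearMap.ker q = Submodule.span ℂ (itpRelations π rE) ∧
      ∀ (ξ : E) (b : B), t ξ b = q (ξ ⊗ₜ[ℂ] b)
  sm_t : ∀ (ξ : E) (b b' : B), rEB.sm (t ξ b) b' = t ξ (b * b')

/-- The functional space of the internal tensor product `E ⊗_π B`:
the linear span of the functionals `φ ⊗ c` with `(φ ⊗ c)(ξ ⊗ b) = c·π(φ(ξ))·b`. -/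
def internalTheta (π : A → B) (ΘE : Set (E → A)) (t : E → B → EB) : Set (EB → B) :=
  ↑(Submodule.span ℂ { h : EB → B | ∃ φ ∈ ΘE, ∃ c : B,
      (∀ x y, h (x + y) = h x + h y) ∧ ∀ (ξ : E) (b : B), h (t ξ b) = c * π (φ ξ) * b })

end ITP

theorem map_sum_of_map_add {M N ι : Type*} [AddCommGroup M] [AddCommGroup N] {f : M → N}
    (hf : ∀ x y, f (x + y) = f x + f y) (s : Finset ι) (x : ι → M) :
    f (∑ i ∈ s, x i) = ∑ i ∈ s, f (x i) :=
  map_sum (AddMonoidHom.mk' f hf) x s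

theorem HasLeftApproxUnit.exists_of_finite {A : Type*} [NonUnitalRing A]
    (hA : HasLeftApproxUnit A) {ι : Type*} [Finite ι] (a : ι → A) : ∃ u : A, ∀ i, u * a i = a i := by
  obtain ⟨n, ⟨e⟩⟩ := Finite.exists_equiv_fin ι
  obtain ⟨u, hu⟩ := hA n (a ∘ e.symm)
  exact ⟨u, fun i => by simpa using hu (e i)⟩

section ModuleLemmas

variable {A E : Type*} [NonUnitalRing A] [Module ℂ A] [AddCommGroup E] [Module ℂ E]

variable {r : RightMod A E} {Θ : Set (E → A)}

theorem elemOp_mem_KSet (η : E) {φ : E → A} (hφ : φ ∈ Θ) : elemOp r η φ ∈ KSet r Θ :=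
  ⟨1, fun _ => η, fun _ => φ, fun _ => hφ, by simp⟩

theorem map_add_of_mem_KSet (hΘ : ∀ φ ∈ Θ, ∀ x y, φ (x + y) = φ x + φ y) {U : E → E}
    (hU : U ∈ KSet r Θ) (x y : E) : U (x + y) = U x + U y := by
  obtain ⟨m, η, φ, hφ, rfl⟩ := hU
  simp only [Finset.sum_apply, elemOp, ← Finset.sum_add_distrib]
  exact Finset.sum_congr rfl fun i _ => by rw [hΘ _ (hφ i), r.sm_add]

/-- A left approximate unit of `A` also acts as a unit on finitely many elements of a cofull
functional space. -/
theorem CofullTheta.exists_left_unit (hcoθ : CofullTheta r Θ) (hA : HasLeftApproxUnit A)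
    {ι : Type*} [Finite ι] {φ : ι → E → A} (hφ : ∀ i, φ i ∈ Θ) :
    ∃ u : A, ∀ i x, u * φ i x = φ i x := by
  choose m ξ ψ τ _ _ hsum using fun i => hcoθ (φ i) (hφ i)
  obtain ⟨u, hu⟩ := hA.exists_of_finite fun p : Σ i, Fin (m i) => ψ p.1 p.2 (ξ p.1 p.2)
  refine ⟨u, fun i x => ?_⟩
  rw [hsum i, Finset.sum_apply, Finset.mul_sum]
  exact Finset.sum_congr rfl fun j _ => by rw [← mul_assoc, hu ⟨i, j⟩]

variable (r Θ) in
/-- The filter of compact operators that are two-sided units for larger and larger finite sets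
of compact operators. -/
def unitFilter : Filter (E → E) where
  sets := { s | ∃ L : Set (E → E), L.Finite ∧ L ⊆ KSet r Θ ∧
    ∀ U ∈ KSet r Θ, (∀ S ∈ L, U ∘ S = S ∧ S ∘ U = S) → U ∈ s }
  univ_sets := ⟨∅, Set.finite_empty, Set.empty_subset _, fun _ _ _ => Set.mem_univ _⟩
  sets_of_superset := by
    rintro s s' ⟨L, hL, hLK, h⟩ hs
    exact ⟨L, hL, hLK, fun U hU hUL => hs (h U hU hUL)⟩
  inter_sets := by
    rintro s s' ⟨L, hL, hLK, h⟩ ⟨L', hL', hLK', h'⟩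
    exact ⟨L ∪ L', hL.union hL', Set.union_subset hLK hLK', fun U hU hUL =>
      ⟨h U hU fun S hS => hUL S (.inl hS), h' U hU fun S hS => hUL S (.inr hS)⟩⟩

theorem KSetHasTwoSidedApproxUnit.exists_of_eventually (hK : KSetHasTwoSidedApproxUnit r Θ)
    {p : (E → E) → Prop} (hp : ∀ᶠ U in unitFilter r Θ, p U) : ∃ U ∈ KSet r Θ, p U := by
  obtain ⟨L, hL, hLK, h⟩ := hp
  obtain ⟨n, ⟨e⟩⟩ := @Finite.exists_equiv_fin L hL
  obtain ⟨U, hU, hUL⟩ := hK n (fun i => e.symm i) fun i => hLK (e.symm i).2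
  exact ⟨U, hU, h U hU fun S hS => by simpa using hUL (e ⟨S, hS⟩)⟩

theorem eventually_mem_KSet : ∀ᶠ U in unitFilter r Θ, U ∈ KSet r Θ :=
  ⟨∅, Set.finite_empty, Set.empty_subset _, fun _ hU _ => hU⟩

theorem eventually_comp_eq {S : E → E} (hS : S ∈ KSet r Θ) :
    ∀ᶠ U in unitFilter r Θ, U ∘ S = S ∧ S ∘ U = S :=
  ⟨{S}, Set.finite_singleton S, Set.singleton_subset_iff.2 hS, fun _ _ h => h S rfl⟩

theorem CofullModule.eventually_apply_eq (hE : IsFunctionalSpace r Θ) (hco : CofullModule r Θ)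
    (ξ : E) : ∀ᶠ U in unitFilter r Θ, U ξ = ξ := by
  obtain ⟨m, η, ζ, φ, hφ, rfl⟩ := hco ξ
  filter_upwards [eventually_mem_KSet, Filter.eventually_all.2 fun i =>
    eventually_comp_eq (elemOp_mem_KSet (r := r) (η i) (hφ i))] with U hU h
  rw [map_sum_of_map_add (map_add_of_mem_KSet (fun φ hφ => (hE.functional φ hφ).1) hU)]
  exact Finset.sum_congr rfl fun i _ => congrFun (h i).1 (ζ i)

theorem CofullTheta.eventually_comp_eq (hE : IsFunctionalSpace r Θ) (hcoθ : CofullTheta r Θ)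
    {φ : E → A} (hφ : φ ∈ Θ) : ∀ᶠ U in unitFilter r Θ, ∀ x, φ (U x) = φ x := by
  obtain ⟨m, ξ, ψ, τ, hψ, hτ, rfl⟩ := hcoθ φ hφ
  filter_upwards [Filter.eventually_all.2 fun i =>
    _root_.eventually_comp_eq (elemOp_mem_KSet (r := r) (ξ i) (hτ i))] with U h x
  simp only [Finset.sum_apply, ← (hE.functional _ (hψ _)).2.2]
  exact Finset.sum_congr rfl fun i _ => congrArg (ψ i) (congrFun (h i).2 x)

end ModuleLemmas

section InternalTensor

variable {A B E EB : Type*} [NonUnitalRing A] [Module ℂ A] [NonUnitalRing B] [Module ℂ B]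
  [AddCommGroup E] [Module ℂ E] [AddCommGroup EB] [Module ℂ EB]
  {rE : RightMod A E} {ΘE : Set (E → A)} {π : A → B} {rEB : RightMod B EB} {t : E → B → EB}

namespace IsInternalTensor

theorem add_left (ht : IsInternalTensor π rE rEB t) (ξ η : E) (b : B) :
    t (ξ + η) b = t ξ b + t η b := by
  obtain ⟨q, -, -, hq⟩ := ht.exists_quot
  simp only [hq, TensorProduct.add_tmul, map_add]

theorem sm_left (ht : IsInternalTensor π rE rEB t) (ξ : E) (a : A) (b : B) :
    t (rE.sm ξ a) b = t ξ (π a * b) := by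
  obtain ⟨q, -, hker, hq⟩ := ht.exists_quot
  rw [hq, hq, ← sub_eq_zero, ← map_sub, ← LinearMap.mem_ker, hker]
  exact Submodule.subset_span ⟨ξ, a, b, rfl⟩

theorem induction_on (ht : IsInternalTensor π rE rEB t) {p : EB → Prop} (x : EB)
    (tmul : ∀ ξ b, p (t ξ b)) (add : ∀ x y, p x → p y → p (x + y)) : p x := by
  obtain ⟨q, hsurj, -, hq⟩ := ht.exists_quot
  obtain ⟨z, rfl⟩ := hsurj x
  induction z using TensorProduct.induction_on with
  | zero => simpa [hq] using tmul 0 0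
  | tmul ξ b => exact hq ξ b ▸ tmul ξ b
  | add z w hz hw => exact (map_add q z w).symm ▸ add _ _ hz hw

/-- The functional `φ ⊗ c` on the internal tensor product. -/
theorem exists_functional [SMulCommClass ℂ B B] [IsScalarTower ℂ B B]
    (ht : IsInternalTensor π rE rEB t) (hπ : IsAlgHom π) {φ : E → A} (hφ : IsFunctional rE φ)
    (c : B) : ∃ h : EB →ₗ[ℂ] B, ∀ ξ b, h (t ξ b) = c * π (φ ξ) * b := by
  obtain ⟨q, hsurj, hker, hq⟩ := ht.exists_quot
  let g : TensorProduct ℂ E B →ₗ[ℂ] B := TensorProduct.lift <|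
    LinearMap.mk₂ ℂ (fun ξ b => c * π (φ ξ) * b)
      (fun ξ η b => by simp only [hφ.1, hπ.1, mul_add, add_mul])
      (fun z ξ b => by simp only [hφ.2.1, hπ.2.2, mul_smul_comm, smul_mul_assoc])
      (fun ξ b b' => mul_add _ _ _)
      (fun z ξ b => mul_smul_comm _ _ _)
  have hg : LinearMap.ker q ≤ LinearMap.ker g := by
    rw [hker, Submodule.span_le]
    rintro _ ⟨ξ, a, b, rfl⟩
    simp [g, hφ.2.2, hπ.2.1, mul_assoc]
  obtain ⟨s, hs⟩ := q.exists_rightInverse_of_surjective (LinearMap.range_eq_top.2 hsurj)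
  refine ⟨g ∘ₗ s, fun ξ b => ?_⟩
  have hmem : s (t ξ b) - ξ ⊗ₜ[ℂ] b ∈ LinearMap.ker q := by
    rw [LinearMap.mem_ker, map_sub, ← hq, sub_eq_zero]
    exact LinearMap.congr_fun hs (t ξ b)
  have := hg hmem
  rw [LinearMap.mem_ker, map_sub, sub_eq_zero] at this
  simpa [g] using this

/-- For a compact operator `U` on `E`, the operator `U ⊗ 1` on `E ⊗_π B` is compact. -/
theorem exists_mem_KSet [SMulCommClass ℂ B B] [IsScalarTower ℂ B B]
    (ht : IsInternalTensor π rE rEB t) (hπ : IsAlgHom π) (hE : IsFunctionalSpace rE ΘE)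
    (hcoθ : CofullTheta rE ΘE) (hA : HasLeftApproxUnit A) {U : E → E} (hU : U ∈ KSet rE ΘE) :
    ∃ V ∈ KSet rEB (internalTheta π ΘE t), (∀ x y, V (x + y) = V x + V y) ∧
      ∀ ξ b, V (t ξ b) = t (U ξ) b := by
  obtain ⟨m, η, φ, hφ, rfl⟩ := hU
  obtain ⟨u, hu⟩ := hcoθ.exists_left_unit hA hφ
  choose h hh using fun i => ht.exists_functional hπ (hE.functional _ (hφ i)) (π u)
  refine ⟨∑ i, elemOp rEB (t (η i) (π u)) (h i), ⟨m, _, _, fun i =>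
    Submodule.subset_span ⟨φ i, hφ i, π u, map_add (h i), hh i⟩, rfl⟩, fun x y => ?_,
    fun ξ b => ?_⟩
  · simp only [Finset.sum_apply, elemOp, map_add, rEB.sm_add, Finset.sum_add_distrib]
  · rw [Finset.sum_apply, Finset.sum_apply,
      map_sum_of_map_add (f := (t · b)) fun x y => ht.add_left x y b]
    refine Finset.sum_congr rfl fun i _ => ?_
    rw [elemOp, elemOp, hh, ht.sm_t, ht.sm_left, ← hπ.2.1, hu, ← mul_assoc, ← hπ.2.1, hu]

theorem eventually_apply_sm (ht : IsInternalTensor π rE rEB t) (hE : IsFunctionalSpace rE ΘE)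
    (hco : CofullModule rE ΘE) (x : EB) :
    ∀ᶠ U in unitFilter rE ΘE, ∀ V : EB → EB, (∀ x y, V (x + y) = V x + V y) →
      (∀ ξ b, V (t ξ b) = t (U ξ) b) → ∀ b, V (rEB.sm x b) = rEB.sm x b := by
  induction x using ht.induction_on with
  | tmul ξ b =>
    filter_upwards [hco.eventually_apply_eq hE ξ] with U hU V _ hV b'
    rw [ht.sm_t, hV, hU]
  | add x y hx hy =>
    filter_upwards [hx, hy] with U hUx hUy V hVadd hV b
    rw [rEB.add_sm, hVadd, hUx V hVadd hV, hUy V hVadd hV]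

theorem eventually_functional_apply (ht : IsInternalTensor π rE rEB t)
    (hE : IsFunctionalSpace rE ΘE) (hcoθ : CofullTheta rE ΘE) {ψ : EB → B}
    (hψ : ψ ∈ internalTheta π ΘE t) :
    ∀ᶠ U in unitFilter rE ΘE, ∀ V : EB → EB, (∀ x y, V (x + y) = V x + V y) →
      (∀ ξ b, V (t ξ b) = t (U ξ) b) → ∀ x, ψ (V x) = ψ x := by
  induction hψ using Submodule.span_induction with
  | mem h hh =>
    obtain ⟨φ, hφ, c, hadd, hh⟩ := hh
    filter_upwards [hcoθ.eventually_comp_eq hE hφ] with U hU V hVadd hV x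
    induction x using ht.induction_on with
    | tmul ξ b => rw [hV, hh, hh, hU]
    | add x y hx hy => rw [hVadd, hadd, hadd, hx, hy]
  | zero => simp
  | add f g _ _ hf hg =>
    filter_upwards [hf, hg] with U hUf hUg V hVadd hV x
    rw [Pi.add_apply, Pi.add_apply, hUf V hVadd hV, hUg V hVadd hV]
  | smul c f _ hf =>
    filter_upwards [hf] with U hUf V hVadd hV x
    rw [Pi.smul_apply, Pi.smul_apply, hUf V hVadd hV]

end IsInternalTensor

end InternalTensor

/-- If `E` and its functional space are cofull, `A` has a left approximate unit and `K_A(E)` has a two-sided approximate unit, then for any algebra homomorphism `π : A → B`, the algebra `K_B(E ⊗_π B)` has a two-sided approximate unit. -/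
theorem internalTensor_hasTwoSidedApproxUnit
    {A B E EB : Type*} [NonUnitalRing A] [Module ℂ A]
    [SMulCommClass ℂ A A] [IsScalarTower ℂ A A]
    [NonUnitalRing B] [Module ℂ B] [SMulCommClass ℂ B B] [IsScalarTower ℂ B B]
    [AddCommGroup E] [Module ℂ E] [AddCommGroup EB] [Module ℂ EB]
    (rE : RightMod A E) (ΘE : Set (E → A)) (hE : IsFunctionalSpace rE ΘE)
    (hco : CofullModule rE ΘE) (hcoθ : CofullTheta rE ΘE)
    (hA : HasLeftApproxUnit A)
    (hK : KSetHasTwoSidedApproxUnit rE ΘE)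
    (π : A → B) (hπ : IsAlgHom π)
    (rEB : RightMod B EB) (t : E → B → EB)
    (ht : IsInternalTensor π rE rEB t) :
    KSetHasTwoSidedApproxUnit rEB (internalTheta π ΘE t) := by
  suffices h : ∀ T ∈ KSet rEB (internalTheta π ΘE t), ∀ᶠ U in unitFilter rE ΘE,
      ∀ V : EB → EB, (∀ x y, V (x + y) = V x + V y) → (∀ ξ b, V (t ξ b) = t (U ξ) b) →
        V ∘ T = T ∧ T ∘ V = T by
    intro m T hT
    obtain ⟨U, hU, hUT⟩ :=
      hK.exists_of_eventually (Filter.eventually_all.2 fun i => h (T i) (hT i))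
    obtain ⟨V, hVK, hVadd, hV⟩ := ht.exists_mem_KSet hπ hE hcoθ hA hU
    exact ⟨V, hVK, fun i => hUT i V hVadd hV⟩
  rintro _ ⟨m, η, ψ, hψ, rfl⟩
  filter_upwards [Filter.eventually_all.2 fun i => ht.eventually_apply_sm hE hco (η i),
    Filter.eventually_all.2 fun i => ht.eventually_functional_apply hE hcoθ (hψ i)]
    with U hUη hUψ V hVadd hV
  constructor <;> ext x
  · rw [Function.comp_apply, Finset.sum_apply, map_sum_of_map_add hVadd]
    exact Finset.sum_congr rfl fun i _ => hUη i V hVadd hV _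
  · simp only [Function.comp_apply, Finset.sum_apply, elemOp, fun i => hUψ i V hVadd hV x]
end

section
/- Let G be a finite group, (A,α) an algebra with G-action, and (E, S, Θ_A(E)) a G-equivariant right functional (A,α)-module. Equip ⊕_{g∈G} E (finitely supported families, here all families) with the right A-action (⊕_g ξ_g)·a := ⊕_g ξ_g·α_{g⁻¹}(a), the shift G-action U_h(⊕_g ξ_g) := ⊕_g ξ_{h⁻¹g}, and the functional space {⊕_g α_g ∘ χ_g : χ_g ∈ Θ_A(E)} = {⊕_g φ_g ∘ S_g : φ_g ∈ Θ_A(E)}, where (⊕_g ψ_g)(⊕_g ξ_g) := Σ_g ψ_g(ξ_g). Then π(ξ) := ⊕_{g∈G} S_{g⁻¹}(ξ) together with π^*(φ) := (1/|G|) ⊕_{g∈G} φ ∘ S_g defines a G-equivariant functional extension π : (E, S) → (⊕_{g∈G} E, U). -/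
open scoped BigOperators TensorProduct

/-- A `G`-action on the algebra `A` by (ℂ-linear) algebra automorphisms. -/
structure AlgAction (G : Type*) [Group G] (A : Type*) [NonUnitalRing A] [Module ℂ A] where
  act : G → A → A
  map_add : ∀ (g : G) (x y : A), act g (x + y) = act g x + act g y
  map_mul : ∀ (g : G) (x y : A), act g (x * y) = act g x * act g y
  map_csmul : ∀ (g : G) (c : ℂ) (x : A), act g (c • x) = c • act g x
  act_one : ∀ x : A, act 1 x = x
  act_mul : ∀ (g h : G) (x : A), act (g * h) x = act g (act h x)

/-- A `G`-action on a right `A`-module compatible with the action `α` on `A`. -/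
structure ModAction (G : Type*) [Group G] {A E : Type*} [NonUnitalRing A] [Module ℂ A]
    [AddCommGroup E] [Module ℂ E] (α : AlgAction G A) (r : RightMod A E) where
  act : G → E → E
  map_add : ∀ (g : G) (x y : E), act g (x + y) = act g x + act g y
  map_csmul : ∀ (g : G) (c : ℂ) (x : E), act g (c • x) = c • act g x
  act_sm : ∀ (g : G) (x : E) (a : A), act g (r.sm x a) = r.sm (act g x) (α.act g a)
  act_one : ∀ x : E, act 1 x = x
  act_mul : ∀ (g h : G) (x : E), act (g * h) x = act g (act h x)

/-- A linear `G`-action on a ℂ-vector space. -/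
structure LinAction (G : Type*) [Group G] (V : Type*) [AddCommGroup V] [Module ℂ V] where
  act : G → V → V
  map_add : ∀ (g : G) (x y : V), act g (x + y) = act g x + act g y
  map_csmul : ∀ (g : G) (c : ℂ) (x : V), act g (c • x) = c • act g x
  act_one : ∀ x : V, act 1 x = x
  act_mul : ∀ (g h : G) (x : V), act (g * h) x = act g (act h x)

/-- Invariance of a functional space under the induced action `g(φ) = α_g ∘ φ ∘ S_{g⁻¹}`. -/
def ThetaInvariant {G A E : Type*} [Group G] [NonUnitalRing A] [Module ℂ A]
    [AddCommGroup E] [Module ℂ E] {r : RightMod A E}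
    (α : AlgAction G A) (S : ModAction G α r) (Θ : Set (E → A)) : Prop :=
  ∀ g : G, ∀ φ ∈ Θ, (fun ξ => α.act g (φ (S.act g⁻¹ ξ))) ∈ Θ

section Twist

variable {G A E : Type*} [Group G] [NonUnitalRing A] [Module ℂ A]
  [AddCommGroup E] [Module ℂ E]

/-- The right `A`-module `⊕_{g ∈ G} E` (all families, `G` finite in applications)
with the twisted action `(⊕_g ξ_g)·a := ⊕_g ξ_g·α_{g⁻¹}(a)`. -/
def twistMod (α : AlgAction G A) (r : RightMod A E) : RightMod A (G → E) where
  sm x a := fun g => r.sm (x g) (α.act g⁻¹ a)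
  add_sm x y a := by funext g; simp [r.add_sm]
  sm_add x a b := by funext g; simp [α.map_add, r.sm_add]
  sm_mul x a b := by funext g; simp [α.map_mul, r.sm_mul]
  csm_left c x a := by funext g; simp [r.csm_left]
  csm_right c x a := by funext g; simp [α.map_csmul, r.csm_right]

/-- The functional space `{⊕_g α_g ∘ χ_g : χ_g ∈ Θ}` on `⊕_{g ∈ G} E`,
where `(⊕_g ψ_g)(⊕_g ξ_g) = Σ_g ψ_g(ξ_g)`. -/
def twistTheta [Fintype G] (α : AlgAction G A) (Θ : Set (E → A)) : Set ((G → E) → A) :=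
  { f | ∃ χ : G → E → A, (∀ g, χ g ∈ Θ) ∧ ∀ x : G → E, f x = ∑ g : G, α.act g (χ g (x g)) }

/-- The shift `G`-action `U_h(⊕_g ξ_g) := ⊕_g ξ_{h⁻¹g}` on the twisted module. -/
def shiftAction (α : AlgAction G A) (r : RightMod A E) :
    ModAction G α (twistMod α r) where
  act h x := fun g => x (h⁻¹ * g)
  map_add _ _ _ := rfl
  map_csmul _ _ _ := rfl
  act_sm h x a := by
    funext g
    show r.sm (x (h⁻¹ * g)) (α.act (h⁻¹ * g)⁻¹ a) =
      r.sm (x (h⁻¹ * g)) (α.act g⁻¹ (α.act h a))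
    rw [← α.act_mul, mul_inv_rev, inv_inv]
  act_one x := by funext g; simp
  act_mul g h x := by funext k; simp [mul_assoc]

end Twist

lemma ModAction.act_inv_act {G A E : Type*} [Group G] [NonUnitalRing A] [Module ℂ A]
    [AddCommGroup E] [Module ℂ E] {α : AlgAction G A} {r : RightMod A E}
    (S : ModAction G α r) (g : G) (x : E) : S.act g⁻¹ (S.act g x) = x := by
  rw [← S.act_mul, inv_mul_cancel, S.act_one]

lemma ModAction.act_act_inv {G A E : Type*} [Group G] [NonUnitalRing A] [Module ℂ A]
    [AddCommGroup E] [Module ℂ E] {α : AlgAction G A} {r : RightMod A E}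
    (S : ModAction G α r) (g : G) (x : E) : S.act g (S.act g⁻¹ x) = x := by
  rw [← S.act_mul, mul_inv_cancel, S.act_one]

lemma AlgAction.act_act_inv {G A : Type*} [Group G] [NonUnitalRing A] [Module ℂ A]
    (α : AlgAction G A) (g : G) (a : A) : α.act g (α.act g⁻¹ a) = a := by
  rw [← α.act_mul, mul_inv_cancel, α.act_one]

lemma AlgAction.act_sum {G A ι : Type*} [Group G] [NonUnitalRing A] [Module ℂ A]
    (α : AlgAction G A) (g : G) (s : Finset ι) (f : ι → A) :
    α.act g (∑ i ∈ s, f i) = ∑ i ∈ s, α.act g (f i) :=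
  map_sum (AddMonoidHom.mk' (α.act g) (α.map_add g)) f s

lemma IsFunctional.map_sum {A E ι : Type*} [NonUnitalRing A] [Module ℂ A]
    [AddCommGroup E] [Module ℂ E] {r : RightMod A E} {φ : E → A}
    (hφ : IsFunctional r φ) (s : Finset ι) (f : ι → E) :
    φ (∑ i ∈ s, f i) = ∑ i ∈ s, φ (f i) :=
  _root_.map_sum (AddMonoidHom.mk' φ hφ.1) f s

/-- The two descriptions `{⊕_g α_g ∘ χ_g}` and `{⊕_g φ_g ∘ S_g}` of the functional space of
the twisted module agree. -/
lemma twistTheta_eq {G A E : Type*} [Group G] [Fintype G] [NonUnitalRing A] [Module ℂ A]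
    [AddCommGroup E] [Module ℂ E] {α : AlgAction G A} {r : RightMod A E} {Θ : Set (E → A)}
    (S : ModAction G α r) (hinv : ThetaInvariant α S Θ) :
    twistTheta α Θ =
      { f : (G → E) → A | ∃ φ : G → E → A, (∀ g, φ g ∈ Θ) ∧
        ∀ x : G → E, f x = ∑ g : G, φ g (S.act g (x g)) } := by
  ext f
  constructor
  · rintro ⟨χ, hχ, hf⟩
    refine ⟨fun g ξ => α.act g (χ g (S.act g⁻¹ ξ)), fun g => hinv g _ (hχ g), fun x => ?_⟩
    simp only [hf, S.act_inv_act]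
  · rintro ⟨φ, hφ, hf⟩
    refine ⟨fun g ξ => α.act g⁻¹ (φ g (S.act g⁻¹⁻¹ ξ)), fun g => hinv g⁻¹ _ (hφ g),
      fun x => ?_⟩
    simp only [hf, α.act_act_inv, inv_inv]

/-- For a finite group `G` and a `G`-equivariant right
functional `(A,α)`-module `(E,S)`, the averaged regular representation
`π(ξ) = ⊕_g S_{g⁻¹}(ξ)`, `π^*(φ) = (1/|G|) ⊕_g φ ∘ S_g` is a `G`-equivariant
functional extension of `(E,S)` into `(⊕_{g∈G} E, U)` with the shift action `U`
and the twisted module structure. -/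
theorem regular_embedding_functional_extension
    {G A E : Type*} [Group G] [Fintype G] [NonUnitalRing A] [Module ℂ A]
    [SMulCommClass ℂ A A] [IsScalarTower ℂ A A] [AddCommGroup E] [Module ℂ E]
    (α : AlgAction G A) (rE : RightMod A E) (ΘE : Set (E → A))
    (hE : IsFunctionalSpace rE ΘE)
    (S : ModAction G α rE) (hinv : ThetaInvariant α S ΘE) :
    -- the two descriptions of the functional space of `⊕_{g ∈ G} E` agree
    twistTheta α ΘE =
      { f : (G → E) → A | ∃ φ : G → E → A, (∀ g, φ g ∈ ΘE) ∧
        ∀ x : G → E, f x = ∑ g : G, φ g (S.act g (x g)) } ∧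
    -- `(π, π^*)` is a functional extension
    IsFunctionalExtension rE ΘE (twistMod α rE) (twistTheta α ΘE)
      (fun ξ => fun g => S.act g⁻¹ ξ)
      (fun φ => fun x => ((Fintype.card G : ℂ))⁻¹ • ∑ g : G, φ (S.act g (x g))) ∧
    -- `π` is `G`-equivariant
    (∀ (g : G) (ξ : E),
      (fun h => S.act h⁻¹ (S.act g ξ)) =
        (shiftAction α rE).act g (fun h => S.act h⁻¹ ξ)) ∧
    -- `π^*` is `G`-equivariant
    (∀ (g : G), ∀ φ ∈ ΘE,
      (fun x : G → E => ((Fintype.card G : ℂ))⁻¹ •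
          ∑ h : G, (fun ξ => α.act g (φ (S.act g⁻¹ ξ))) (S.act h (x h))) =
        fun x : G → E => α.act g (((Fintype.card G : ℂ))⁻¹ •
          ∑ h : G, φ (S.act h ((shiftAction α rE).act g⁻¹ x h)))) := by
  have hcard : (Fintype.card G : ℂ) ≠ 0 := Nat.cast_ne_zero.mpr Fintype.card_ne_zero
  refine ⟨twistTheta_eq S hinv, ?_, ?_, ?_⟩
  · refine ⟨⟨⟨fun x y => ?_, fun c x => ?_, fun x a => ?_⟩, fun {φ} hφ => ?_,
      fun {φ ψ} _ _ => ?_, fun c {φ} _ => ?_, fun a {φ} _ => ?_, fun {φ} _ x => ?_⟩,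
      fun x y hxy => ?_, fun k φ hφ η => ?_⟩
    · funext g
      exact S.map_add _ _ _
    · funext g
      exact S.map_csmul _ _ _
    · funext g
      exact S.act_sm _ _ _
    · rw [twistTheta_eq S hinv]
      exact ⟨fun _ => ((Fintype.card G : ℂ))⁻¹ • φ, fun _ => hE.csmul_mem _ hφ,
        fun x => by simp [Finset.smul_sum]⟩
    · funext x
      simp [Finset.sum_add_distrib]
    · funext x
      simp only [Pi.smul_apply, ← Finset.smul_sum]
      exact smul_comm _ _ _
    · funext x
      simp only [← Finset.mul_sum, mul_smul_comm]
    · simp only [S.act_act_inv, Finset.sum_const, Finset.card_univ]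
      rw [← Nat.cast_smul_eq_nsmul ℂ, inv_smul_smul₀ hcard]
    · simpa [S.act_one] using congrFun hxy 1
    · refine ⟨((Fintype.card G : ℂ))⁻¹ • ∑ g : G, S.act g (η g), fun i => ?_⟩
      have hi := hE.functional _ (hφ i)
      rw [hi.2.1, hi.map_sum]
  · intro g ξ
    funext h
    simp only [shiftAction, mul_inv_rev, inv_inv, S.act_mul]
  · intro g φ _
    funext x
    rw [α.map_csmul, α.act_sum]
    congr 1
    refine (Fintype.sum_equiv (Equiv.mulLeft g) _ _ fun h => ?_).symm
    simp [shiftAction, S.act_mul, S.act_inv_act]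
end
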